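/- For every x > 0 and 0 < y < 1, lim_{n→∞} n·√(2n)·N(n, ⌈x·√(2n)⌉, ⌈y·n⌉)/D(n) = (2^{1/4}/(Γ(3/4)·√π))·(x/(y(1−y)))^{3/2}·exp(−x²/(2y(1−y))). (This is the local limit theorem for the joint law of the rescaled cycle length L_n^•/√(2n) and external area A_n^•/n of a uniform pointed well-labelled unicycle with n edges.) -/

import Mathlib

open Filter

/-- The central trinomial coefficient `t_k`: the number of sequences
`(s_1, …, s_k) ∈ {-1,0,1}^k` with `s_1 + ⋯ + s_k = 0`. -/
def trinom (k : ℕ) : ℕ :=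
  (Finset.univ.filter (fun s : Fin k → Fin 3 => (∑ i, ((s i : ℤ) - 1)) = 0)).card

/-- `F(a,b) = (a/(a+2b)) C(a+2b, b)`, the number of plane forests with `a` trees
and `b` edges. -/
noncomputable def Fforest (a b : ℕ) : ℝ :=
  ((a : ℝ) / ((a : ℝ) + 2 * b)) * (Nat.choose (a + 2 * b) b : ℝ)

/-- `N(n,h,i) = 3^{n-h} t_h F(h,i) F(h, n-h-i)`, the number of pointed
well-labelled unicycles with `n` edges, cycle length `h` and external area `i`. -/
noncomputable def Ncount (n h i : ℕ) : ℝ :=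
  (3 : ℝ) ^ (n - h) * (trinom h : ℝ) * Fforest h i * Fforest h (n - h - i)

/-- `D(n) = ∑_{h=1}^n ∑_{i=0}^{n-h} N(n,h,i)`. -/
noncomputable def Dcount (n : ℕ) : ℝ :=
  ∑ h ∈ Finset.Icc 1 n, ∑ i ∈ Finset.range (n - h + 1), Ncount n h i

/-- The ballot numbers `C(a+2b-1, b) - C(a+2b-1, b-1)`, counting plane forests with `a` trees
and `b` edges. -/
noncomputable def forestCoeff (a : ℕ) : ℕ → ℝ
  | 0 => 1
  | b + 1 => (Nat.choose (a + 2 * b + 1) (b + 1) : ℝ) - Nat.choose (a + 2 * b + 1) b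

lemma forestCoeff_zero_succ (b : ℕ) : forestCoeff 0 (b + 1) = 0 := by
  have : (2 * b + 1).choose (b + 1) = (2 * b + 1).choose b := by
    apply Nat.choose_symm_of_eq_add; ring
  simp [forestCoeff, this]

lemma forestCoeff_succ_succ (a b : ℕ) :
    forestCoeff (a + 1) (b + 1) = forestCoeff a (b + 1) + forestCoeff (a + 2) b := by
  cases b with
  | zero => simp [forestCoeff]
  | succ b =>
    simp only [forestCoeff]
    rw [show a + 1 + 2 * (b + 1) + 1 = (a + 2 * (b + 1) + 1) + 1 by ring,
      show a + 2 + 2 * b + 1 = a + 2 * (b + 1) + 1 by ring]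
    simp only [Nat.choose_succ_succ (a + 2 * (b + 1) + 1)]
    push_cast
    ring

/-- The generating function of the ballot numbers `forestCoeff a`. -/
noncomputable def forestSeries (a : ℕ) : PowerSeries ℝ := PowerSeries.mk (forestCoeff a)

lemma forestSeries_zero : forestSeries 0 = 1 := by
  ext n
  cases n with
  | zero => simp [forestSeries, forestCoeff]
  | succ n => simp [forestSeries, forestCoeff_zero_succ, PowerSeries.coeff_one]

lemma forestSeries_succ (a : ℕ) :
    forestSeries (a + 1) = forestSeries a + PowerSeries.X * forestSeries (a + 2) := by
  ext n
  cases n with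
  | zero => simp [forestSeries, forestCoeff]
  | succ n => simp [forestSeries, forestCoeff_succ_succ, PowerSeries.coeff_succ_X_mul]

lemma forestSeries_mul (a c : ℕ) :
    forestSeries a * forestSeries c = forestSeries (a + c) := by
  have key : ∀ n a, PowerSeries.coeff n (forestSeries a * forestSeries c - forestSeries (a + c))
      = 0 := by
    have step : ∀ a, forestSeries (a + 1) * forestSeries c - forestSeries (a + 1 + c) =
        (forestSeries a * forestSeries c - forestSeries (a + c)) +
        PowerSeries.X * (forestSeries (a + 2) * forestSeries c - forestSeries (a + 2 + c)) := by
      intro a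
      rw [show a + 1 + c = (a + c) + 1 by ring, forestSeries_succ a, forestSeries_succ (a + c),
        show a + c + 2 = a + 2 + c by ring]
      ring
    intro n
    induction n with
    | zero =>
      intro a
      induction a with
      | zero => simp [forestSeries_zero]
      | succ a ih => rw [step, map_add, ih]; simp
    | succ n ihn =>
      intro a
      induction a with
      | zero => simp [forestSeries_zero]
      | succ a ih => rw [step, map_add, ih, PowerSeries.coeff_succ_X_mul, ihn, add_zero]
  rw [← sub_eq_zero]
  ext n
  simpa using key n a

lemma Fforest_eq_forestCoeff {a : ℕ} (ha : 1 ≤ a) (b : ℕ) : Fforest a b = forestCoeff a b := by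
  have ha' : (0 : ℝ) < a := by exact_mod_cast ha
  cases b with
  | zero => simp [Fforest, forestCoeff, ha'.ne']
  | succ b =>
    have h1 := Nat.add_one_mul_choose_eq (a + 2 * b + 1) b
    have h2 := Nat.choose_succ_right_eq (a + 2 * b + 1) b
    rw [show a + 2 * b + 1 - b = a + b + 1 by omega] at h2
    have habsorb : ((a : ℝ) + 2 * b + 1 + 1) * ((a + 2 * b + 1).choose b : ℝ)
      = ((a + 2 * b + 1 + 1).choose (b + 1) : ℝ) * (b + 1) := by exact_mod_cast h1
    have hratio : ((a + 2 * b + 1).choose (b + 1) : ℝ) * (b + 1)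
      = ((a + 2 * b + 1).choose b : ℝ) * (a + b + 1) := by exact_mod_cast h2
    have hb : (0 : ℝ) < b + 1 := by positivity
    simp only [Fforest, forestCoeff]
    rw [show a + 2 * (b + 1) = a + 2 * b + 1 + 1 by ring]
    push_cast
    rw [div_mul_eq_mul_div, div_eq_iff (by positivity)]
    apply mul_right_cancel₀ hb.ne'
    rw [mul_assoc, ← habsorb]
    linear_combination (-((a:ℝ) + 2 * (b+1))) * hratio

/-- The convolution identity for plane forests. -/
lemma sum_Fforest_mul {h : ℕ} (hh : 1 ≤ h) (m : ℕ) :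
    ∑ i ∈ Finset.range (m + 1), Fforest h i * Fforest h (m - i) = Fforest (2 * h) m := by
  have := congrArg (PowerSeries.coeff m) (forestSeries_mul h h)
  rw [PowerSeries.coeff_mul, Finset.Nat.sum_antidiagonal_eq_sum_range_succ
    (fun i j => PowerSeries.coeff i (forestSeries h) * PowerSeries.coeff j (forestSeries h)),
    ← two_mul] at this
  simpa [forestSeries, Fforest_eq_forestCoeff hh,
    Fforest_eq_forestCoeff (show 1 ≤ 2 * h by omega)] using this

lemma Fforest_two_mul {n h : ℕ} (hh : 1 ≤ h) (hn : h ≤ n) :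
    Fforest (2 * h) (n - h) = (h : ℝ) / n * ((2 * n).choose (n - h) : ℝ) := by
  have : (0:ℝ) < n := by exact_mod_cast hh.trans hn
  rw [Fforest, show 2 * h + 2 * (n - h) = 2 * n by omega, Nat.cast_sub hn]
  congr 1
  push_cast
  rw [show (2 : ℝ) * h + 2 * (n - h) = 2 * n by ring]
  exact mul_div_mul_left _ _ two_ne_zero

lemma tendsto_mul_cos_div_sqrt_sub_one (u : ℝ) :
    Tendsto (fun m : ℕ => (m : ℝ) * (Real.cos (u / √(m : ℝ)) - 1)) atTop (nhds (-(u ^ 2 / 2))) := by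
  have h0 : Tendsto (fun m : ℕ => u / √(m : ℝ)) atTop (nhds 0) :=
    tendsto_const_nhds.div_atTop (Real.tendsto_sqrt_atTop.comp tendsto_natCast_atTop_atTop)
  have h1 : ∀ᶠ m : ℕ in atTop, |u / √(m : ℝ)| ≤ 1 := by
    filter_upwards [h0.eventually (Metric.closedBall_mem_nhds 0 one_pos)] with m hm
    simpa only [Metric.mem_closedBall, dist_zero_right, Real.norm_eq_abs] using hm
  rw [tendsto_iff_norm_sub_tendsto_zero]
  have h2 : Tendsto (fun m : ℕ => u ^ 4 * (5 / 96) / (m : ℝ)) atTop (nhds 0) :=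
    tendsto_const_nhds.div_atTop tendsto_natCast_atTop_atTop
  refine squeeze_zero' (Eventually.of_forall fun _ => norm_nonneg _) ?_ h2
  filter_upwards [h1, eventually_gt_atTop 0] with m hm hm0
  have hm0' : (0 : ℝ) < m := by exact_mod_cast hm0
  have hsq : √(m : ℝ) ^ 2 = m := Real.sq_sqrt hm0'.le
  have hb := Real.cos_bound hm
  have e : (m : ℝ) * (Real.cos (u / √(m : ℝ)) - 1) - -(u ^ 2 / 2) =
      m * (Real.cos (u / √(m : ℝ)) - (1 - (u / √(m : ℝ)) ^ 2 / 2)) := by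
    rw [div_pow, hsq]; field_simp; ring
  rw [e, Real.norm_eq_abs, abs_mul, abs_of_pos hm0']
  refine (mul_le_mul_of_nonneg_left hb hm0'.le).trans_eq ?_
  rw [← abs_pow, abs_of_nonneg (by positivity), div_pow,
    show √(m : ℝ) ^ 4 = (√(m : ℝ) ^ 2) ^ 2 by ring, hsq]
  field_simp

lemma integral_exp_neg_mul_sq_mul_cos {b : ℝ} (hb : 0 < b) (c : ℝ) :
    ∫ u : ℝ, Real.exp (-b * u ^ 2) * Real.cos (c * u) = √(Real.pi / b) *
      Real.exp (-c ^ 2 / (4 * b)) := by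
  have h := fourierIntegral_gaussian (b := (b : ℂ)) (by simpa using hb) (c : ℂ)
  have hint : MeasureTheory.Integrable (fun x : ℝ =>
      Complex.exp (Complex.I * c * x) * Complex.exp (-b * x ^ 2)) := by
    have := (integrable_cexp_neg_mul_sq (b := (b : ℂ)) (by simpa using hb))
    refine this.bdd_mul (c := 1) (by fun_prop) (Eventually.of_forall fun x => ?_)
    rw [show Complex.I * c * x = ((c * x : ℝ) : ℂ) * Complex.I by push_cast; ring,
      Complex.norm_exp_ofReal_mul_I]
  have h2 := integral_re hint
  have e1 : ∀ x : ℝ, RCLike.re (Complex.exp (Complex.I * c * x) * Complex.exp (-b * x ^ 2))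
      = Real.exp (-b * x ^ 2) * Real.cos (c * x) := by
    intro x
    rw [show Complex.I * c * x = ((c * x : ℝ) : ℂ) * Complex.I by push_cast; ring,
      show (-b * x ^ 2 : ℂ) = ((-b * x ^ 2 : ℝ) : ℂ) by push_cast; ring, ← Complex.ofReal_exp, mul_comm]
    exact (Complex.re_ofReal_mul _ _).trans (by rw [Complex.exp_ofReal_mul_I_re])
  simp_rw [e1] at h2
  rw [h2, h]
  have e2 : ((Real.pi : ℂ) / b) ^ (1 / 2 : ℂ) * Complex.exp (-(c : ℂ) ^ 2 / (4 * b)) =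
      ((√(Real.pi / b) * Real.exp (-c ^ 2 / (4 * b)) : ℝ) : ℂ) := by
    rw [Real.sqrt_eq_rpow]
    push_cast [Complex.ofReal_cpow (show 0 ≤ Real.pi / b by positivity)]
    rfl
  rw [e2]
  exact Complex.ofReal_re _

/-- The Laplace method for a characteristic function `φ` with a quadratic maximum at `0`, tested
against a cosine of frequency of order `√m`. -/
lemma tendsto_sqrt_mul_integral_pow_mul_cos {φ : ℝ → ℝ} (hφ : Continuous φ) {a κ σ : ℝ}
    (ha : 0 < a) (hκ : 0 < κ) (hσ : 0 < σ)
    (hbound : ∀ θ, |θ| ≤ a → |φ θ| ≤ Real.exp (-κ * θ ^ 2))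
    (hlim : ∀ u : ℝ, Tendsto (fun m : ℕ => (m : ℝ) * (φ (u / √(m : ℝ)) - 1)) atTop
      (nhds (-(σ * u ^ 2))))
    {m d : ℕ → ℕ} {c : ℝ} (hm : Tendsto m atTop atTop)
    (hd : Tendsto (fun k => (d k : ℝ) / √(m k : ℝ)) atTop (nhds c)) :
    Tendsto (fun k => √(m k : ℝ) * ∫ θ in (-a)..a, φ θ ^ m k * Real.cos (d k * θ)) atTop
      (nhds (√(Real.pi / σ) * Real.exp (-c ^ 2 / (4 * σ)))) := by
  rw [← integral_exp_neg_mul_sq_mul_cos hσ]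
  have hs : Tendsto (fun k => √(m k : ℝ)) atTop atTop :=
    Real.tendsto_sqrt_atTop.comp (tendsto_natCast_atTop_atTop.comp hm)
  let F : ℕ → ℝ → ℝ := fun k => Set.indicator (Set.Ioc (-a * √(m k : ℝ)) (a * √(m k : ℝ)))
    (fun u => φ (u / √(m k : ℝ)) ^ m k * Real.cos (d k * (u / √(m k : ℝ))))
  have hF : ∀ᶠ k in atTop, ∫ u, F k u =
      √(m k : ℝ) * ∫ θ in (-a)..a, φ θ ^ m k * Real.cos (d k * θ) := by
    filter_upwards [hs.eventually_gt_atTop 0] with k hk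
    have := intervalIntegral.integral_comp_div (a := -a * √(m k : ℝ)) (b := a * √(m k : ℝ))
      (fun θ => φ θ ^ m k * Real.cos (d k * θ)) hk.ne'
    rw [mul_div_cancel_right₀ _ hk.ne', mul_div_cancel_right₀ _ hk.ne'] at this
    rw [← smul_eq_mul, ← this, intervalIntegral.integral_of_le (by nlinarith),
      MeasureTheory.integral_indicator measurableSet_Ioc]
  refine Tendsto.congr' hF ?_
  refine MeasureTheory.tendsto_integral_of_dominated_convergence
    (fun u => Real.exp (-κ * u ^ 2)) (fun k => ?_) (integrable_exp_neg_mul_sq hκ) (fun k => ?_) ?_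
  · refine (Continuous.aestronglyMeasurable ?_).indicator measurableSet_Ioc
    fun_prop
  · refine Eventually.of_forall fun u => ?_
    by_cases hu : u ∈ Set.Ioc (-a * √(m k : ℝ)) (a * √(m k : ℝ))
    · simp only [F, Set.indicator_of_mem hu]
      have hs0 : 0 < √(m k : ℝ) := by
        by_contra hcon
        have : √(m k : ℝ) = 0 := le_antisymm (not_lt.1 hcon) (Real.sqrt_nonneg _)
        rw [this] at hu
        simp only [mul_zero] at hu
        exact absurd (hu.1.trans_le hu.2) (lt_irrefl _)
      rw [norm_mul, norm_pow, Real.norm_eq_abs, Real.norm_eq_abs]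
      have h1 : |u / √(m k : ℝ)| ≤ a := by
        rw [abs_le, le_div_iff₀ hs0, div_le_iff₀ hs0]
        exact ⟨hu.1.le, hu.2⟩
      calc |φ (u / √(m k : ℝ))| ^ m k * |Real.cos (d k * (u / √(m k : ℝ)))|
          ≤ Real.exp (-κ * (u / √(m k : ℝ)) ^ 2) ^ m k * 1 := by
            gcongr
            · exact hbound _ h1
            · exact Real.abs_cos_le_one _
        _ = Real.exp (-κ * u ^ 2) := by
            rw [mul_one, ← Real.exp_nat_mul]
            congr 1
            rw [div_pow, Real.sq_sqrt (Nat.cast_nonneg _)]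
            have : (m k : ℝ) ≠ 0 := by
              intro h; rw [h] at hs0; simp at hs0
            field_simp
    · simp only [F, Set.indicator_of_notMem hu, norm_zero]
      positivity
  · refine Eventually.of_forall fun u => ?_
    have h1 : Tendsto (fun k => φ (u / √(m k : ℝ)) ^ m k) atTop (nhds (Real.exp (-σ * u ^ 2))) := by
      have := (Real.tendsto_one_add_pow_exp_of_tendsto (hlim u)).comp hm
      rw [neg_mul]
      refine this.congr fun k => ?_
      simp
    have h2 : Tendsto (fun k => Real.cos (d k * (u / √(m k : ℝ)))) atTop
        (nhds (Real.cos (c * u))) := by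
      refine (Real.continuous_cos.tendsto _).comp ?_
      refine (hd.mul_const u).congr fun k => ?_
      ring
    refine (h1.mul h2).congr' ?_
    have h3 : Tendsto (fun k => a * √(m k : ℝ)) atTop atTop := hs.const_mul_atTop ha
    filter_upwards [h3.eventually_gt_atTop |u|] with k hk
    have hu : u ∈ Set.Ioc (-a * √(m k : ℝ)) (a * √(m k : ℝ)) := by
      have := abs_lt.1 hk
      exact ⟨by linarith [this.1], this.2.le⟩
    simp only [F, Set.indicator_of_mem hu]

lemma integral_exp_int_mul_I (T : ℝ) (k : ℤ) (hT : ∃ l : ℤ, k * T = l * Real.pi) :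
    ∫ θ in (-T)..T, Complex.exp (k * θ * Complex.I) = if k = 0 then 2 * (T : ℂ) else 0 := by
  split_ifs with hk
  · simp [hk]; ring
  · have hk' : (k : ℂ) * Complex.I ≠ 0 := by simp [hk]
    have := integral_exp_mul_complex (a := -T) (b := T) hk'
    simp_rw [mul_right_comm (k : ℂ) Complex.I] at this
    rw [this, div_eq_zero_iff]
    left
    rw [sub_eq_zero, Complex.exp_eq_exp_iff_exists_int]
    obtain ⟨l, hl⟩ := hT
    refine ⟨l, ?_⟩
    have hl' : (k : ℂ) * T = l * Real.pi := by exact_mod_cast hl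
    push_cast
    linear_combination 2 * Complex.I * hl'

lemma integral_re_eq_re_integral {f : ℝ → ℂ} (hf : Continuous f) (a b : ℝ) :
    ∫ θ in a..b, (f θ).re = (∫ θ in a..b, f θ).re :=
  Complex.reCLM.intervalIntegral_comp_comm (hf.intervalIntegrable _ _)

lemma integral_trinom (k : ℕ) :
    ∫ θ in (-Real.pi)..Real.pi, (1 + 2 * Real.cos θ) ^ k = 2 * Real.pi * trinom k := by
  have e : ∀ θ : ℝ, (((1 + 2 * Real.cos θ) ^ k : ℝ) : ℂ) =
      ∑ s : Fin k → Fin 3, Complex.exp (((∑ i, ((s i : ℤ) - 1) : ℤ) : ℂ) * θ * Complex.I) := by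
    intro θ
    have h1 : (((1 + 2 * Real.cos θ) : ℝ) : ℂ) =
        ∑ a : Fin 3, Complex.exp ((((a : ℕ) : ℤ) - 1 : ℤ) * θ * Complex.I) := by
      rw [Fin.sum_univ_three]
      simp [Complex.two_cos]
      ring
    rw [Complex.ofReal_pow, h1, Fintype.sum_pow]
    refine Finset.sum_congr rfl fun s _ => ?_
    rw [← Complex.exp_sum]
    congr 1
    push_cast
    rw [Finset.sum_mul, Finset.sum_mul]
  have h2 : ∫ θ in (-Real.pi)..Real.pi, (((1 + 2 * Real.cos θ) ^ k : ℝ) : ℂ) =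
      2 * Real.pi * trinom k := by
    simp_rw [e]
    rw [intervalIntegral.integral_finsetSum]
    · simp_rw [integral_exp_int_mul_I Real.pi _ ⟨_, rfl⟩]
      rw [← Finset.sum_filter, Finset.sum_const, trinom, nsmul_eq_mul, mul_comm]
    · intro s _
      exact Continuous.intervalIntegrable (by fun_prop) _ _
  rw [intervalIntegral.integral_ofReal] at h2
  exact_mod_cast h2

lemma integral_choose (d i : ℕ) :
    ∫ θ in (-(Real.pi / 2))..(Real.pi / 2), Real.cos θ ^ (d + 2 * i) * Real.cos (d * θ) =
      Real.pi * (d + 2 * i).choose i / 2 ^ (d + 2 * i) := by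
  set m := d + 2 * i with hm
  have e : ∀ θ : ℝ, ((2 * Real.cos θ : ℝ) : ℂ) ^ m * Complex.exp (d * θ * Complex.I) =
      ∑ j ∈ Finset.range (m + 1),
        (m.choose j : ℂ) * Complex.exp ((2 * (j - i) : ℤ) * θ * Complex.I) := by
    intro θ
    have h1 : ((2 * Real.cos θ : ℝ) : ℂ) =
        Complex.exp (θ * Complex.I) + Complex.exp (-(θ * Complex.I)) := by
      simp [Complex.two_cos]
    rw [h1, add_pow, Finset.sum_mul]
    refine Finset.sum_congr rfl fun j hj => ?_
    have hj : j ≤ m := by simpa [Nat.lt_succ_iff] using hj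
    rw [← Complex.exp_nat_mul, ← Complex.exp_nat_mul, mul_comm (m.choose j : ℂ), ← Complex.exp_add,
      mul_right_comm, ← Complex.exp_add]
    congr 2
    rw [Nat.cast_sub hj, hm]
    push_cast
    ring
  have h2 : ∫ θ in (-(Real.pi / 2))..(Real.pi / 2),
      ((2 * Real.cos θ : ℝ) : ℂ) ^ m * Complex.exp (d * θ * Complex.I) =
      Real.pi * (m.choose i : ℂ) := by
    simp_rw [e]
    rw [intervalIntegral.integral_finsetSum]
    · have h3 : ∀ j : ℕ, ∫ θ in (-(Real.pi / 2))..(Real.pi / 2),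
          (m.choose j : ℂ) * Complex.exp ((2 * (j - i) : ℤ) * θ * Complex.I) =
          if j = i then Real.pi * (m.choose j : ℂ) else 0 := by
        intro j
        rw [intervalIntegral.integral_const_mul,
          integral_exp_int_mul_I (Real.pi / 2) _ ⟨(j : ℤ) - i, by push_cast; ring⟩]
        by_cases hji : j = i
        · simp [hji]; ring
        · have : (2 * ((j : ℤ) - i)) ≠ 0 := by omega
          simp [hji, sub_eq_zero]
      simp_rw [h3]
      rw [Finset.sum_ite_eq' , if_pos (by simp; omega)]
    · intro s _
      exact Continuous.intervalIntegrable (by fun_prop) _ _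
  have h4 := congrArg Complex.re h2
  rw [← integral_re_eq_re_integral (by fun_prop)] at h4
  have h5 : ∀ θ : ℝ, (((2 * Real.cos θ : ℝ) : ℂ) ^ m * Complex.exp (d * θ * Complex.I)).re =
      2 ^ m * (Real.cos θ ^ m * Real.cos (d * θ)) := by
    intro θ
    rw [← Complex.ofReal_pow, show (d * θ * Complex.I : ℂ) = ((d * θ : ℝ) : ℂ) * Complex.I by
      push_cast; ring, Complex.re_ofReal_mul, Complex.exp_ofReal_mul_I_re]
    ring
  simp_rw [h5] at h4
  rw [intervalIntegral.integral_const_mul] at h4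
  rw [eq_div_iff (by positivity), mul_comm, h4]
  norm_cast

lemma abs_one_add_two_mul_cos_div_three_le {θ : ℝ} (hθ : |θ| ≤ Real.pi) :
    |(1 + 2 * Real.cos θ) / 3| ≤ Real.exp (-(1 / Real.pi ^ 2) * θ ^ 2) := by
  have hpi := Real.pi_pos
  have h1 := Real.cos_le_one_sub_mul_cos_sq hθ
  have h2 := Real.neg_one_le_cos θ
  have h3 : θ ^ 2 ≤ Real.pi ^ 2 := sq_le_sq' (abs_le.1 hθ).1 (abs_le.1 hθ).2
  set t := 1 / Real.pi ^ 2 * θ ^ 2 with ht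
  have ht0 : 0 ≤ t := by positivity
  have ht1 : t ≤ 1 := by
    rw [ht, one_div, inv_mul_le_iff₀ (by positivity)]; simpa using h3
  have h1' : Real.cos θ ≤ 1 - 2 * t := by
    refine h1.trans_eq ?_
    rw [ht]; ring
  rw [neg_mul, ← ht, abs_le]
  constructor
  · have h4 : Real.exp (-1) ≤ Real.exp (-t) := Real.exp_le_exp.2 (by linarith)
    have h5 : (1 / 3 : ℝ) ≤ Real.exp (-1) := by
      rw [Real.exp_neg, ← one_div]
      exact one_div_le_one_div_of_le (Real.exp_pos 1) (by linarith [Real.exp_one_lt_d9])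
    linarith
  · have := Real.add_one_le_exp (-t)
    linarith

lemma tendsto_sqrt_mul_trinom :
    Tendsto (fun k : ℕ => √(k : ℝ) * (trinom k / 3 ^ k)) atTop
      (nhds (√(3 * Real.pi) / (2 * Real.pi))) := by
  have hpi := Real.pi_pos
  have h := tendsto_sqrt_mul_integral_pow_mul_cos (φ := fun θ => (1 + 2 * Real.cos θ) / 3)
    (by fun_prop) hpi (show 0 < 1 / Real.pi ^ 2 by positivity) (show (0 : ℝ) < 1 / 3 by norm_num)
    (fun θ hθ => abs_one_add_two_mul_cos_div_three_le hθ)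
    (fun u => ?_) (m := fun k => k) (d := fun _ => 0) (c := 0) tendsto_id (by simp)
  · have h' := h.div_const (2 * Real.pi)
    have e : √(Real.pi / (1 / 3)) * Real.exp (-0 ^ 2 / (4 * (1 / 3))) / (2 * Real.pi) =
        √(3 * Real.pi) / (2 * Real.pi) := by
      rw [div_div_eq_mul_div, div_one, mul_comm Real.pi]; simp
    rw [e] at h'
    refine h'.congr fun k => ?_
    have : ∀ θ : ℝ, ((1 + 2 * Real.cos θ) / 3) ^ k * Real.cos ((0 : ℕ) * θ) =
        (1 + 2 * Real.cos θ) ^ k / 3 ^ k := by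
      intro θ; rw [div_pow]; simp
    simp_rw [this]
    rw [intervalIntegral.integral_div, integral_trinom]
    field_simp
  · have := (tendsto_mul_cos_div_sqrt_sub_one u).const_mul (2 / 3)
    rw [show -(1 / 3 * u ^ 2) = 2 / 3 * -(u ^ 2 / 2) by ring]
    refine this.congr fun m => ?_
    ring

/-- The local central limit theorem for the simple random walk, along a sequence of binomial
coefficients. -/
lemma tendsto_sqrt_mul_choose {d i : ℕ → ℕ} {c : ℝ}
    (hm : Tendsto (fun k => d k + 2 * i k) atTop atTop)
    (hd : Tendsto (fun k => (d k : ℝ) / √((d k + 2 * i k : ℕ) : ℝ)) atTop (nhds c)) :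
    Tendsto (fun k => √((d k + 2 * i k : ℕ) : ℝ) *
        (((d k + 2 * i k).choose (i k) : ℝ) / 2 ^ (d k + 2 * i k))) atTop
      (nhds (√(2 * Real.pi) / Real.pi * Real.exp (-c ^ 2 / 2))) := by
  have hpi := Real.pi_pos
  have h := tendsto_sqrt_mul_integral_pow_mul_cos (φ := Real.cos)
    Real.continuous_cos (show 0 < Real.pi / 2 by positivity)
    (show 0 < 2 / Real.pi ^ 2 by positivity) (show (0 : ℝ) < 1 / 2 by norm_num)
    (fun θ hθ => ?_) (fun u => ?_) hm hd
  · have h' := h.div_const Real.pi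
    have e : √(Real.pi / (1 / 2)) * Real.exp (-c ^ 2 / (4 * (1 / 2))) / Real.pi =
        √(2 * Real.pi) / Real.pi * Real.exp (-c ^ 2 / 2) := by
      rw [div_div_eq_mul_div, div_one, mul_comm Real.pi, show (4 : ℝ) * (1 / 2) = 2 by norm_num]
      ring
    rw [e] at h'
    refine h'.congr fun k => ?_
    rw [integral_choose]
    field_simp
  · have h0 := Real.cos_nonneg_of_mem_Icc ⟨(abs_le.1 hθ).1, (abs_le.1 hθ).2⟩
    rw [abs_of_nonneg h0]
    have h1 := Real.cos_le_one_sub_mul_cos_sq (hθ.trans (by linarith))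
    have h2 := Real.add_one_le_exp (-(2 / Real.pi ^ 2) * θ ^ 2)
    linarith
  · rw [show -(1 / 2 * u ^ 2) = -(u ^ 2 / 2) by ring]
    exact tendsto_mul_cos_div_sqrt_sub_one u

/-- A Gaussian tail bound for binomial coefficients. -/
lemma choose_two_mul_sub_le (n h : ℕ) (hn : h ≤ n) :
    ((2 * n).choose (n - h) : ℝ) ≤ (2 * n).choose n * Real.exp (-((h : ℝ) ^ 2 / (2 * n))) := by
  induction h with
  | zero => simp
  | succ h ih =>
    have ih := ih (by omega)
    have hn0 : (0 : ℝ) < n := by exact_mod_cast (by omega : 0 < n)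
    have hle : (h : ℝ) + 1 ≤ n := by exact_mod_cast hn
    have h1 := Nat.choose_succ_right_eq (2 * n) (n - (h + 1))
    rw [show n - (h + 1) + 1 = n - h by omega, show 2 * n - (n - (h + 1)) = n + h + 1 by omega] at h1
    have h2 : ((2 * n).choose (n - h) : ℝ) * (n - h) =
        (2 * n).choose (n - (h + 1)) * (n + h + 1) := by
      rw [← Nat.cast_sub (by omega : h ≤ n)]
      exact_mod_cast h1
    have h3 : ((n : ℝ) - h) / (n + h + 1) ≤ Real.exp (-((2 * h + 1) / (2 * n))) := by
      refine le_trans ?_ (Real.add_one_le_exp _)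
      rw [div_le_iff₀ (by positivity)]
      have h4 : (-((2 * h + 1) / (2 * n)) + 1 : ℝ) * (n + h + 1) - (n - h) =
          (2 * h + 1) / (2 * n) * (n - (h + 1)) := by
        field_simp; ring
      have h5 : 0 ≤ (2 * h + 1 : ℝ) / (2 * n) * (n - (h + 1)) :=
        mul_nonneg (by positivity) (by linarith)
      linarith
    have h6 : ((2 * n).choose (n - (h + 1)) : ℝ) =
        (2 * n).choose (n - h) * ((n - h) / (n + h + 1)) := by
      rw [mul_div_assoc', h2, mul_div_cancel_right₀ _ (by positivity)]
    rw [h6]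
    calc ((2 * n).choose (n - h) : ℝ) * ((n - h) / (n + h + 1))
        ≤ ((2 * n).choose n * Real.exp (-((h : ℝ) ^ 2 / (2 * n)))) *
          Real.exp (-((2 * h + 1) / (2 * n))) :=
          mul_le_mul ih h3 (div_nonneg (by linarith) (by positivity)) (by positivity)
      _ = _ := by
          rw [mul_assoc, ← Real.exp_add]
          congr 2
          push_cast
          field_simp
          ring

lemma integral_Ioi_comp_ceil {g : ℕ → ℝ} {n : ℕ} (hg : ∀ h, n < h → g h = 0) :
    ∫ t in Set.Ioi (0 : ℝ), g ⌈t⌉₊ = ∑ h ∈ Finset.Icc 1 n, g h := by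
  have hcongr : ∀ k : ℕ, Set.EqOn (fun _ : ℝ => g (k + 1)) (fun t => g ⌈t⌉₊)
      (Set.uIoc (k : ℝ) ((k + 1 : ℕ) : ℝ)) := by
    intro k t ht
    rw [Set.uIoc_of_le (by push_cast; linarith)] at ht
    have : ⌈t⌉₊ = k + 1 := by
      rw [Nat.ceil_eq_iff (by omega)]
      simpa using ht
    simp [this]
  have h1 : ∫ t in Set.Ioi (0 : ℝ), g ⌈t⌉₊ = ∫ t in Set.Ioc (0 : ℝ) n, g ⌈t⌉₊ := by
    refine (MeasureTheory.setIntegral_eq_of_subset_of_forall_sdiff_eq_zero measurableSet_Ioi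
      Set.Ioc_subset_Ioi_self fun t ht => ?_)
    refine hg _ (Nat.lt_ceil.2 ?_)
    by_contra hcon
    exact ht.2 ⟨ht.1, not_lt.1 hcon⟩
  rw [h1, ← intervalIntegral.integral_of_le (Nat.cast_nonneg n)]
  have h2 := intervalIntegral.sum_integral_adjacent_intervals (a := fun k : ℕ => (k : ℝ))
    (f := fun t => g ⌈t⌉₊) (μ := MeasureTheory.volume) (n := n)
    (fun k _ => (intervalIntegrable_const (c := g (k + 1))).congr (hcongr k))
  simp only [Nat.cast_zero] at h2
  rw [← h2, Finset.range_eq_Ico]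
  have h3 : ∀ k : ℕ, ∫ t in (k : ℝ)..((k + 1 : ℕ) : ℝ), g ⌈t⌉₊ = g (k + 1) := by
    intro k
    rw [← intervalIntegral.integral_congr_ae (Eventually.of_forall fun t ht => hcongr k ht)]
    simp
  simp_rw [h3]
  rw [Finset.sum_Ico_add' g 0 n 1]
  rfl

lemma sqrt_le_exp_sq_div_four (v : ℝ) : √v ≤ Real.exp (v ^ 2 / 4) := by
  refine le_trans ?_ (Real.add_one_le_exp _)
  rw [Real.sqrt_le_left (by positivity)]
  nlinarith [sq_nonneg (v - 2), sq_nonneg v]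

lemma Dcount_eq (n : ℕ) :
    Dcount n = ∑ h ∈ Finset.Icc 1 n,
      (3 : ℝ) ^ (n - h) * trinom h * (h / n * (2 * n).choose (n - h)) := by
  refine Finset.sum_congr rfl fun h hh => ?_
  obtain ⟨h1, h2⟩ := Finset.mem_Icc.1 hh
  rw [← Fforest_two_mul h1 h2, ← sum_Fforest_mul h1, Finset.mul_sum]
  simp only [Ncount, mul_assoc]

/-- The rescaled contribution of cycle length `h` to `Dcount n`. -/
noncomputable def lengthWeight (n h : ℕ) : ℝ :=
  if h ≤ n then √(h : ℝ) * (trinom h / 3 ^ h) * (√(n : ℝ) * ((2 * n).choose (n - h) / 2 ^ (2 * n)))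
    * √(h / √(n : ℝ)) else 0

/-- The rescaled normalizing sum as the integral of a step function. -/
lemma Dcount_rescaled {n : ℕ} (hn : 0 < n) :
    Dcount n * (√(n : ℝ) * √√(n : ℝ)) / 12 ^ n =
      ∫ u in Set.Ioi (0 : ℝ), lengthWeight n ⌈u * √(n : ℝ)⌉₊ := by
  have hn' : (0 : ℝ) < n := by exact_mod_cast hn
  have hs : 0 < √(n : ℝ) := Real.sqrt_pos.2 hn'
  rw [MeasureTheory.integral_comp_mul_right_Ioi (fun t => lengthWeight n ⌈t⌉₊) 0 hs, zero_mul,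
    integral_Ioi_comp_ceil (g := lengthWeight n) (fun h hh => if_neg (not_le.2 hh)), Dcount_eq, Finset.sum_mul,
    Finset.sum_div, smul_eq_mul, Finset.mul_sum]
  refine Finset.sum_congr rfl fun h hh => ?_
  obtain ⟨h1, h2⟩ := Finset.mem_Icc.1 hh
  rw [lengthWeight, if_pos h2, Real.sqrt_div (Nat.cast_nonneg h)]
  have e12 : (12 : ℝ) ^ n = 3 ^ (n - h) * 3 ^ h * 2 ^ (2 * n) := by
    rw [← pow_add, Nat.sub_add_cancel h2, pow_mul, ← mul_pow]; norm_num
  have hh2 : (h : ℝ) = √(h : ℝ) ^ 2 := (Real.sq_sqrt (Nat.cast_nonneg h)).symm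
  have hn2 : (n : ℝ) = √(n : ℝ) ^ 2 := (Real.sq_sqrt hn'.le).symm
  have hr2 : √(n : ℝ) = √√(n : ℝ) ^ 2 := (Real.sq_sqrt hs.le).symm
  have hr : 0 < √√(n : ℝ) := Real.sqrt_pos.2 hs
  rw [e12]
  generalize ((2 * n).choose (n - h) : ℝ) = C
  generalize (trinom h : ℝ) = t
  generalize √√(n : ℝ) = r at *
  generalize √(n : ℝ) = s at *
  generalize √(h : ℝ) = w at *
  rw [hh2, hn2, hr2]
  field_simp

lemma tendsto_sqrt_natCast_atTop : Tendsto (fun n : ℕ => √(n : ℝ)) atTop atTop :=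
  Real.tendsto_sqrt_atTop.comp tendsto_natCast_atTop_atTop

lemma tendsto_ceil_mul_sqrt_div_sqrt {u : ℝ} (hu : 0 ≤ u) :
    Tendsto (fun n : ℕ => (⌈u * √(n : ℝ)⌉₊ : ℝ) / √(n : ℝ)) atTop (nhds u) :=
  (tendsto_nat_ceil_mul_div_atTop hu).comp tendsto_sqrt_natCast_atTop

lemma tendsto_sqrt_div_natCast : Tendsto (fun n : ℕ => √(n : ℝ) / n) atTop (nhds 0) := by
  simp_rw [Real.sqrt_div_self']
  exact tendsto_const_nhds.div_atTop tendsto_sqrt_natCast_atTop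

lemma tendsto_div_of_tendsto_div_sqrt {h : ℕ → ℕ} {α : ℝ}
    (hh : Tendsto (fun n => (h n : ℝ) / √(n : ℝ)) atTop (nhds α)) :
    Tendsto (fun n => (h n : ℝ) / n) atTop (nhds 0) := by
  have := hh.mul tendsto_sqrt_div_natCast
  rw [mul_zero] at this
  refine this.congr' ?_
  filter_upwards [eventually_gt_atTop 0] with n hn
  have : 0 < √(n : ℝ) := Real.sqrt_pos.2 (by exact_mod_cast hn)
  field_simp

lemma eventually_le_of_tendsto_div {h : ℕ → ℕ}
    (hh : Tendsto (fun n => (h n : ℝ) / n) atTop (nhds 0)) : ∀ᶠ n in atTop, h n ≤ n := by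
  filter_upwards [hh.eventually_lt_const one_pos, eventually_gt_atTop 0] with n h1 hn
  rw [div_lt_one (by exact_mod_cast hn)] at h1
  exact_mod_cast h1.le

lemma tendsto_atTop_of_tendsto_div_sqrt {h : ℕ → ℕ} {α : ℝ} (hα : 0 < α)
    (hh : Tendsto (fun n => (h n : ℝ) / √(n : ℝ)) atTop (nhds α)) : Tendsto h atTop atTop := by
  rw [← tendsto_natCast_atTop_iff (R := ℝ)]
  refine (hh.pos_mul_atTop hα tendsto_sqrt_natCast_atTop).congr' ?_
  filter_upwards [eventually_gt_atTop 0] with n hn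
  have : 0 < √(n : ℝ) := Real.sqrt_pos.2 (by exact_mod_cast hn)
  field_simp

lemma tendsto_sqrt_mul_choose_two_mul_sub {h : ℕ → ℕ} {u : ℝ}
    (hh : Tendsto (fun n => (h n : ℝ) / √(n : ℝ)) atTop (nhds u)) :
    Tendsto (fun n : ℕ => √(n : ℝ) * (((2 * n).choose (n - h n) : ℝ) / 2 ^ (2 * n))) atTop
      (nhds (1 / √Real.pi * Real.exp (-u ^ 2))) := by
  have hle := eventually_le_of_tendsto_div (tendsto_div_of_tendsto_div_sqrt hh)
  have hm : ∀ᶠ n in atTop, 2 * h n + 2 * (n - h n) = 2 * n := by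
    filter_upwards [hle] with n hn; omega
  have h1 : Tendsto (fun n => 2 * h n + 2 * (n - h n)) atTop atTop := by
    refine Tendsto.congr' (EventuallyEq.symm hm) ?_
    exact tendsto_id.const_mul_atTop' two_pos
  have hs2 : (0 : ℝ) < √2 := by positivity
  have h22 : √(2 : ℝ) ^ 2 = 2 := Real.sq_sqrt (by norm_num)
  have h2 : Tendsto (fun n => ((2 * h n : ℕ) : ℝ) / √((2 * h n + 2 * (n - h n) : ℕ) : ℝ)) atTop
      (nhds (√2 * u)) := by
    refine (hh.const_mul √2).congr' ?_
    filter_upwards [hm, eventually_gt_atTop 0] with n hn hn0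
    have : 0 < √(n : ℝ) := Real.sqrt_pos.2 (by exact_mod_cast hn0)
    rw [hn]
    push_cast
    rw [Real.sqrt_mul (by norm_num)]
    field_simp
    rw [h22, mul_comm]
  have h3 := (tendsto_sqrt_mul_choose h1 h2).const_mul (1 / √2)
  have e : 1 / √2 * (√(2 * Real.pi) / Real.pi * Real.exp (-(√2 * u) ^ 2 / 2)) =
      1 / √Real.pi * Real.exp (-u ^ 2) := by
    have hp : √Real.pi ^ 2 = Real.pi := Real.sq_sqrt Real.pi_pos.le
    have hp0 : 0 < √Real.pi := Real.sqrt_pos.2 Real.pi_pos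
    rw [Real.sqrt_mul (by norm_num), mul_pow, h22, neg_div, mul_div_cancel_left₀ _ two_ne_zero]
    generalize Real.exp (-u ^ 2) = E
    nth_rewrite 2 [← hp]
    field_simp
  rw [e] at h3
  refine h3.congr' ?_
  filter_upwards [hm] with n hn
  rw [hn]
  push_cast
  rw [Real.sqrt_mul (by norm_num)]
  field_simp

lemma exists_lengthWeight_le : ∃ K, ∀ n h : ℕ, ∀ u : ℝ, 0 ≤ u → u ≤ h / √(n : ℝ) →
    lengthWeight n h ≤ K * Real.exp (-(1 / 4) * u ^ 2) := by
  obtain ⟨K₁, hK₁⟩ := tendsto_sqrt_mul_trinom.bddAbove_range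
  obtain ⟨K₂, hK₂⟩ := (tendsto_sqrt_mul_choose_two_mul_sub (h := fun _ => 0) (u := 0)
    (by simp)).bddAbove_range
  have hK₁ : ∀ k : ℕ, √(k : ℝ) * (trinom k / 3 ^ k) ≤ K₁ := fun k => hK₁ ⟨k, rfl⟩
  have hK₂ : ∀ n : ℕ, √(n : ℝ) * (((2 * n).choose n : ℝ) / 2 ^ (2 * n)) ≤ K₂ :=
    fun n => hK₂ ⟨n, rfl⟩
  have hK₁0 : 0 ≤ K₁ := le_trans (by positivity) (hK₁ 0)
  have hK₂0 : 0 ≤ K₂ := le_trans (by positivity) (hK₂ 0)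
  refine ⟨K₁ * K₂, fun n h u hu0 hu => ?_⟩
  rw [lengthWeight]
  split_ifs with hn
  · set v := (h : ℝ) / √(n : ℝ) with hv
    have hv2 : (h : ℝ) ^ 2 / (2 * n) = v ^ 2 / 2 := by
      rw [hv, div_pow, Real.sq_sqrt (Nat.cast_nonneg n), div_div, mul_comm]
    have h1 := choose_two_mul_sub_le n h hn
    rw [hv2] at h1
    have h2 : √(n : ℝ) * (((2 * n).choose (n - h) : ℝ) / 2 ^ (2 * n)) ≤
        K₂ * Real.exp (-(v ^ 2 / 2)) := by
      calc √(n : ℝ) * (((2 * n).choose (n - h) : ℝ) / 2 ^ (2 * n))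
          ≤ √(n : ℝ) * (((2 * n).choose n * Real.exp (-(v ^ 2 / 2))) / 2 ^ (2 * n)) := by gcongr
        _ = √(n : ℝ) * (((2 * n).choose n : ℝ) / 2 ^ (2 * n)) * Real.exp (-(v ^ 2 / 2)) := by ring
        _ ≤ _ := by gcongr; exact hK₂ n
    calc _ ≤ K₁ * (K₂ * Real.exp (-(v ^ 2 / 2))) * Real.exp (v ^ 2 / 4) := by
            gcongr
            · exact hK₁ h
            · exact sqrt_le_exp_sq_div_four v
      _ = K₁ * K₂ * Real.exp (-(1 / 4) * v ^ 2) := by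
            rw [← mul_assoc, mul_assoc, ← Real.exp_add]
            congr 2; ring
      _ ≤ _ := by
            gcongr K₁ * K₂ * Real.exp ?_
            nlinarith
  · positivity

lemma tendsto_Dcount_rescaled :
    Tendsto (fun n : ℕ => Dcount n * (√(n : ℝ) * √√(n : ℝ)) / 12 ^ n) atTop
      (nhds (√(3 * Real.pi) / (2 * Real.pi) / √Real.pi * (1 / 2 * Real.Gamma (3 / 4)))) := by
  have hG : ∫ u in Set.Ioi (0 : ℝ), √(3 * Real.pi) / (2 * Real.pi) *
      (1 / √Real.pi * Real.exp (-u ^ 2)) * √u =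
      √(3 * Real.pi) / (2 * Real.pi) / √Real.pi * (1 / 2 * Real.Gamma (3 / 4)) := by
    have h1 := integral_rpow_mul_exp_neg_rpow (p := 2) (q := 1 / 2) two_pos (by norm_num)
    rw [show ((1 / 2 + 1) / 2 : ℝ) = 3 / 4 by norm_num] at h1
    rw [← h1, ← MeasureTheory.integral_const_mul]
    refine MeasureTheory.setIntegral_congr_fun measurableSet_Ioi fun u hu => ?_
    simp only [Real.sqrt_eq_rpow u, Real.rpow_two]
    ring
  rw [← hG]
  refine Tendsto.congr' (f₁ := fun n : ℕ =>
    ∫ u in Set.Ioi (0 : ℝ), lengthWeight n ⌈u * √(n : ℝ)⌉₊) ?_ ?_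
  · filter_upwards [eventually_gt_atTop 0] with n hn
    exact (Dcount_rescaled hn).symm
  obtain ⟨K, hK⟩ := exists_lengthWeight_le
  refine MeasureTheory.tendsto_integral_filter_of_dominated_convergence
    (fun u => K * Real.exp (-(1 / 4) * u ^ 2)) ?_ ?_
    ((integrable_exp_neg_mul_sq (by norm_num)).const_mul K).integrableOn ?_
  · refine Eventually.of_forall fun n => Measurable.aestronglyMeasurable ?_
    exact (measurable_from_nat (f := lengthWeight n)).comp (Nat.measurable_ceil.comp (by fun_prop))
  · filter_upwards [eventually_gt_atTop 0] with n hn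
    refine (MeasureTheory.ae_restrict_iff' measurableSet_Ioi).2 (Eventually.of_forall fun u hu => ?_)
    have hs : 0 < √(n : ℝ) := Real.sqrt_pos.2 (by exact_mod_cast hn)
    have h0 : 0 ≤ lengthWeight n ⌈u * √(n : ℝ)⌉₊ := by
      rw [lengthWeight]; split_ifs <;> positivity
    rw [Real.norm_eq_abs, abs_of_nonneg h0]
    refine hK _ _ _ (le_of_lt hu) ?_
    rw [le_div_iff₀ hs]
    exact Nat.le_ceil _
  · refine (MeasureTheory.ae_restrict_iff' measurableSet_Ioi).2 (Eventually.of_forall fun u hu => ?_)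
    have hu0 : 0 < u := hu
    have hh := tendsto_ceil_mul_sqrt_div_sqrt hu0.le
    have h1 := tendsto_sqrt_mul_trinom.comp (tendsto_atTop_of_tendsto_div_sqrt hu0 hh)
    have h2 := tendsto_sqrt_mul_choose_two_mul_sub hh
    refine ((h1.mul h2).mul hh.sqrt).congr' ?_
    filter_upwards [eventually_le_of_tendsto_div (tendsto_div_of_tendsto_div_sqrt hh)] with n hn
    rw [lengthWeight, if_pos hn]
    rfl

lemma tendsto_mul_Fforest {h i : ℕ → ℕ} {α y : ℝ} (hy : 0 < y)
    (hh : Tendsto (fun n => (h n : ℝ) / √(n : ℝ)) atTop (nhds α))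
    (hi : Tendsto (fun n => (i n : ℝ) / n) atTop (nhds y)) :
    Tendsto (fun n : ℕ => (n : ℝ) * (Fforest (h n) (i n) / 2 ^ (h n + 2 * i n))) atTop
      (nhds (α * (1 / (2 * y)) * √(1 / (2 * y)) *
        (√(2 * Real.pi) / Real.pi * Real.exp (-(α ^ 2 / (4 * y)))))) := by
  have hm : Tendsto (fun n => ((h n + 2 * i n : ℕ) : ℝ) / n) atTop (nhds (2 * y)) := by
    have := (tendsto_div_of_tendsto_div_sqrt hh).add (hi.const_mul 2)
    rw [zero_add] at this
    refine this.congr fun n => ?_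
    push_cast; ring
  have hm1 : Tendsto (fun n : ℕ => (n : ℝ) / ((h n + 2 * i n : ℕ) : ℝ)) atTop
      (nhds (1 / (2 * y))) := by
    rw [one_div]
    refine (hm.inv₀ (by positivity)).congr fun n => ?_
    rw [inv_div]
  have hmpos : ∀ᶠ n in atTop, 0 < n ∧ 0 < h n + 2 * i n := by
    filter_upwards [hm.eventually_const_lt (show 0 < 2 * y by positivity),
      eventually_gt_atTop 0] with n hn hn0
    refine ⟨hn0, ?_⟩
    by_contra hcon
    have : h n + 2 * i n = 0 := by omega
    rw [this] at hn
    simp at hn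
  have hmtop : Tendsto (fun n => h n + 2 * i n) atTop atTop := by
    rw [← tendsto_natCast_atTop_iff (R := ℝ)]
    refine (hm.pos_mul_atTop (by positivity) tendsto_natCast_atTop_atTop).congr' ?_
    filter_upwards [eventually_gt_atTop 0] with n hn
    have : (n : ℝ) ≠ 0 := by exact_mod_cast hn.ne'
    field_simp
  have hd : Tendsto (fun n => (h n : ℝ) / √((h n + 2 * i n : ℕ) : ℝ)) atTop
      (nhds (α * √(1 / (2 * y)))) := by
    refine (hh.mul hm1.sqrt).congr' ?_
    filter_upwards [hmpos] with n hn
    have h1 : 0 < √(n : ℝ) := Real.sqrt_pos.2 (by exact_mod_cast hn.1)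
    have h2 : 0 < √((h n + 2 * i n : ℕ) : ℝ) := Real.sqrt_pos.2 (by exact_mod_cast hn.2)
    rw [Real.sqrt_div (Nat.cast_nonneg n)]
    field_simp
  have key := ((hh.mul hm1).mul hm1.sqrt).mul (tendsto_sqrt_mul_choose hmtop hd)
  rw [show -(α * √(1 / (2 * y))) ^ 2 / 2 = -(α ^ 2 / (4 * y)) by
    rw [mul_pow, Real.sq_sqrt (by positivity)]; field_simp; norm_num] at key
  refine key.congr' ?_
  filter_upwards [hmpos] with n hn
  have h1 : 0 < √(n : ℝ) := Real.sqrt_pos.2 (by exact_mod_cast hn.1)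
  have h2 : 0 < √((h n + 2 * i n : ℕ) : ℝ) := Real.sqrt_pos.2 (by exact_mod_cast hn.2)
  have h3 : (0 : ℝ) < ((h n + 2 * i n : ℕ) : ℝ) := by exact_mod_cast hn.2
  rw [Real.sqrt_div (Nat.cast_nonneg n), Fforest,
    show (h n : ℝ) + 2 * i n = ((h n + 2 * i n : ℕ) : ℝ) by push_cast; ring]
  field_simp

lemma tendsto_Ncount_rescaled {h i : ℕ → ℕ} {α y : ℝ} (hα : 0 < α) (hy0 : 0 < y) (hy1 : y < 1)
    (hh : Tendsto (fun n => (h n : ℝ) / √(n : ℝ)) atTop (nhds α))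
    (hi : Tendsto (fun n => (i n : ℝ) / n) atTop (nhds y)) :
    Tendsto (fun n : ℕ => Ncount n (h n) (i n) * ((n : ℝ) ^ 2 * √√(n : ℝ)) / 12 ^ n) atTop
      (nhds (√(3 * Real.pi) / (2 * Real.pi) *
        ((α * (1 / (2 * y)) * √(1 / (2 * y)) *
          (√(2 * Real.pi) / Real.pi * Real.exp (-(α ^ 2 / (4 * y))))) *
        (α * (1 / (2 * (1 - y))) * √(1 / (2 * (1 - y))) *
          (√(2 * Real.pi) / Real.pi * Real.exp (-(α ^ 2 / (4 * (1 - y))))))) / √α)) := by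
  have hhn := tendsto_div_of_tendsto_div_sqrt hh
  have hle : ∀ᶠ n in atTop, 0 < n ∧ h n + i n ≤ n := by
    have := hhn.add hi
    rw [zero_add] at this
    filter_upwards [this.eventually_lt_const hy1, eventually_gt_atTop 0] with n h1 hn
    refine ⟨hn, ?_⟩
    rw [← add_div, div_lt_one (by exact_mod_cast hn)] at h1
    exact_mod_cast h1.le
  have hj : Tendsto (fun n => ((n - h n - i n : ℕ) : ℝ) / n) atTop (nhds (1 - y)) := by
    have := ((tendsto_const_nhds (x := (1 : ℝ))).sub hhn).sub hi
    rw [sub_zero] at this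
    refine this.congr' ?_
    filter_upwards [hle] with n hn
    have hn0 : (n : ℝ) ≠ 0 := by exact_mod_cast hn.1.ne'
    rw [Nat.cast_sub (by omega), Nat.cast_sub (by omega)]
    field_simp
  have h1 := tendsto_sqrt_mul_trinom.comp (tendsto_atTop_of_tendsto_div_sqrt hα hh)
  have key := (h1.mul ((tendsto_mul_Fforest hy0 hh hi).mul
    (tendsto_mul_Fforest (sub_pos.2 hy1) hh hj))).div hh.sqrt (Real.sqrt_pos.2 hα).ne'
  refine key.congr' ?_
  filter_upwards [hle, hh.eventually_const_lt hα] with n hn hpos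
  have hn0 : (0 : ℝ) < n := by exact_mod_cast hn.1
  have hs : 0 < √(n : ℝ) := Real.sqrt_pos.2 hn0
  have hr : 0 < √√(n : ℝ) := Real.sqrt_pos.2 hs
  have hh0 : (0 : ℝ) < h n := by
    by_contra hcon
    have : (h n : ℝ) = 0 := le_antisymm (not_lt.1 hcon) (Nat.cast_nonneg _)
    rw [this, zero_div] at hpos
    exact lt_irrefl _ hpos
  have hw : 0 < √(h n : ℝ) := Real.sqrt_pos.2 hh0
  have e12 : (12 : ℝ) ^ n = 3 ^ (n - h n) * 3 ^ h n *
      (2 ^ (h n + 2 * i n) * 2 ^ (h n + 2 * (n - h n - i n))) := by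
    rw [← pow_add, ← pow_add, Nat.sub_add_cancel (by omega),
      show h n + 2 * i n + (h n + 2 * (n - h n - i n)) = 2 * n by omega, pow_mul, ← mul_pow]
    norm_num
  simp only [Function.comp, Pi.div_apply]
  rw [e12, Real.sqrt_div (Nat.cast_nonneg _), Ncount]
  field_simp

lemma local_limit_const (x y : ℝ) (hx : 0 < x) (hy0 : 0 < y) (hy1 : y < 1) :
    √2 * ((√(3 * Real.pi) / (2 * Real.pi) *
        ((x * √2 * (1 / (2 * y)) * √(1 / (2 * y)) *
          (√(2 * Real.pi) / Real.pi * Real.exp (-((x * √2) ^ 2 / (4 * y))))) *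
        (x * √2 * (1 / (2 * (1 - y))) * √(1 / (2 * (1 - y))) *
          (√(2 * Real.pi) / Real.pi * Real.exp (-((x * √2) ^ 2 / (4 * (1 - y))))))) / √(x * √2)) /
      (√(3 * Real.pi) / (2 * Real.pi) / √Real.pi * (1 / 2 * Real.Gamma (3 / 4)))) =
    (2 : ℝ) ^ ((1 : ℝ) / 4) / (Real.Gamma (3 / 4) * Real.sqrt Real.pi) *
        (x / (y * (1 - y))) ^ ((3 : ℝ) / 2) *
        Real.exp (-(x ^ 2) / (2 * (y * (1 - y)))) := by
  have hz : 0 < 1 - y := sub_pos.2 hy1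
  have hpi := Real.pi_pos
  have hexp : Real.exp (-(x ^ 2) / (2 * (y * (1 - y)))) =
      Real.exp (-((x * √2) ^ 2 / (4 * y))) * Real.exp (-((x * √2) ^ 2 / (4 * (1 - y)))) := by
    rw [← Real.exp_add, mul_pow, Real.sq_sqrt (by norm_num)]
    congr 1
    field_simp
    ring
  have hpow : (x / (y * (1 - y))) ^ ((3 : ℝ) / 2) =
      x / (y * (1 - y)) * (√x / (√y * √(1 - y))) := by
    rw [show (3 : ℝ) / 2 = 1 + 1 / 2 by norm_num, Real.rpow_add (by positivity), Real.rpow_one,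
      ← Real.sqrt_eq_rpow, Real.sqrt_div hx.le, Real.sqrt_mul hy0.le]
  have htwo : (2 : ℝ) ^ ((1 : ℝ) / 4) = √√2 := by
    rw [Real.sqrt_eq_rpow, Real.sqrt_eq_rpow, ← Real.rpow_mul (by norm_num)]
    norm_num
  rw [hexp, hpow, htwo, Real.sqrt_mul hx.le, Real.sqrt_mul (by norm_num : (0 : ℝ) ≤ 2),
    Real.sqrt_div zero_le_one, Real.sqrt_div zero_le_one, Real.sqrt_mul (by norm_num : (0 : ℝ) ≤ 2),
    Real.sqrt_mul (by norm_num : (0 : ℝ) ≤ 2), Real.sqrt_one]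
  have hG : 0 < Real.Gamma (3 / 4) := Real.Gamma_pos_of_pos (by norm_num)
  have hP : 0 < √Real.pi := Real.sqrt_pos.2 hpi
  have hP2 : √Real.pi ^ 2 = Real.pi := Real.sq_sqrt hpi.le
  have hX : 0 < √x := Real.sqrt_pos.2 hx
  have hX2 : √x ^ 2 = x := Real.sq_sqrt hx.le
  have hY : 0 < √y := Real.sqrt_pos.2 hy0
  have hZ : 0 < √(1 - y) := Real.sqrt_pos.2 hz
  have h3 : 0 < √(3 * Real.pi) := Real.sqrt_pos.2 (by positivity)
  have hR : (0 : ℝ) < √√2 := by positivity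
  have hR2 : √√(2 : ℝ) ^ 2 = √2 := Real.sq_sqrt (Real.sqrt_nonneg 2)
  have hS : (0 : ℝ) < √2 := by positivity
  have hS2 : √(2 : ℝ) ^ 2 = 2 := Real.sq_sqrt (by norm_num)
  generalize Real.exp (-((x * √2) ^ 2 / (4 * y))) = E₁
  generalize Real.exp (-((x * √2) ^ 2 / (4 * (1 - y)))) = E₂
  generalize Real.Gamma (3 / 4) = G at *
  generalize √(3 * Real.pi) = A at *
  generalize √Real.pi = P at *
  generalize √(1 - y) = Z at *
  generalize √y = Y at *
  generalize √x = X at *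
  generalize √√(2 : ℝ) = R at *
  generalize √(2 : ℝ) = S at *
  generalize 1 - y = z at *
  rw [← hP2, ← hX2]
  field_simp
  rw [hR2]
  linear_combination S * E₁ * E₂ * hS2

/-- Local limit theorem for the joint law of the rescaled cycle length and
external area of a uniform pointed well-labelled unicycle with `n` edges. -/
theorem local_limit_length_area (x y : ℝ) (hx : 0 < x) (hy0 : 0 < y) (hy1 : y < 1) :
    Tendsto (fun n : ℕ =>
        (n : ℝ) * Real.sqrt (2 * n) *
          Ncount n ⌈x * Real.sqrt (2 * n)⌉₊ ⌈y * (n : ℝ)⌉₊ / Dcount n)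
      atTop
      (nhds ((2 : ℝ) ^ ((1 : ℝ) / 4) / (Real.Gamma (3 / 4) * Real.sqrt Real.pi) *
        (x / (y * (1 - y))) ^ ((3 : ℝ) / 2) *
        Real.exp (-(x ^ 2) / (2 * (y * (1 - y)))))) := by
  rw [← local_limit_const x y hx hy0 hy1]
  have hα : 0 < x * √2 := by positivity
  have hh : Tendsto (fun n : ℕ => (⌈x * √(2 * (n : ℝ))⌉₊ : ℝ) / √(n : ℝ)) atTop
      (nhds (x * √2)) := by
    refine (tendsto_ceil_mul_sqrt_div_sqrt hα.le).congr fun n => ?_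
    rw [Real.sqrt_mul (by norm_num), mul_assoc]
  have hi : Tendsto (fun n : ℕ => (⌈y * (n : ℝ)⌉₊ : ℝ) / n) atTop (nhds y) :=
    (tendsto_nat_ceil_mul_div_atTop hy0.le).comp tendsto_natCast_atTop_atTop
  have hG : 0 < Real.Gamma (3 / 4) := Real.Gamma_pos_of_pos (by norm_num)
  have key := ((tendsto_Ncount_rescaled hα hy0 hy1 hh hi).div tendsto_Dcount_rescaled
    (by positivity)).const_mul √2
  refine key.congr' ?_
  filter_upwards [eventually_gt_atTop 0] with n hn
  have hn0 : (0 : ℝ) < n := by exact_mod_cast hn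
  have hs : 0 < √(n : ℝ) := Real.sqrt_pos.2 hn0
  have hr : 0 < √√(n : ℝ) := Real.sqrt_pos.2 hs
  have hs2 : (n : ℝ) = √(n : ℝ) ^ 2 := (Real.sq_sqrt hn0.le).symm
  simp only [Pi.div_apply]
  rw [div_div_div_cancel_right₀ (by positivity)]
  generalize Ncount n ⌈x * √(2 * n)⌉₊ ⌈y * n⌉₊ = N
  rw [Real.sqrt_mul (by norm_num)]
  rw [show N * ((n : ℝ) ^ 2 * √√(n : ℝ)) / (Dcount n * (√(n : ℝ) * √√(n : ℝ))) =
    N * n * √(n : ℝ) / Dcount n by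
      rw [show N * ((n : ℝ) ^ 2 * √√(n : ℝ)) =
        (N * n * √(n : ℝ)) * (√(n : ℝ) * √√(n : ℝ)) by
          linear_combination (N * n * √√(n : ℝ)) * hs2]
      exact mul_div_mul_right _ _ (by positivity)]
  ring
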